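/- Let n ≥ 1, let x ∈ ℝ^n have x_i > 0 for all i, set M := max_{i∈[n]} (1/x_i) and L := {ℓ ∈ ℝ^n : 0 ≤ ℓ_i ≤ M for all i, ℓ·x = 1}, let C ⊆ ℝ^n be a finite nonempty set of vectors with nonnegative entries, let α ≥ 1 and ε > 0. Suppose that for every ℓ ∈ L there exists c ∈ C with c·ℓ ≤ α. Then there exists a probability distribution λ on C such that for every ℓ ∈ L, (Σ_{c∈C} λ_c c)·ℓ ≤ (α + ε)·(x·ℓ). -/

import Mathlib

open Finset

/-- A finite-dimensional minimax principle: if every nonnegative linear functional is at most its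
value at `z` somewhere on the finite set `C`, then some convex combination of `C` lies coordinatewise
below `z`. -/
theorem exists_mem_convexHull_le {ι : Type*} [Fintype ι] (C : Finset (ι → ℝ)) (z : ι → ℝ)
    (h : ∀ p : ι → ℝ, (∀ i, 0 ≤ p i) → ∃ c ∈ C, ∑ i, c i * p i ≤ ∑ i, z i * p i) :
    ∃ y ∈ convexHull ℝ (C : Set (ι → ℝ)), y ≤ z := by
  classical
  by_contra! hne
  have hdisj : Disjoint (convexHull ℝ (C : Set (ι → ℝ))) (Set.Iic z) :=
    Set.disjoint_left.2 fun y hy hyz => hne y hy hyz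
  obtain ⟨f, u, v, hfu, huv, hfv⟩ := geometric_hahn_banach_compact_closed
    (convex_convexHull ℝ _) (C.finite_toSet.isCompact_convexHull (𝕜 := ℝ)) (convex_Iic z) isClosed_Iic hdisj
  have hf (y : ι → ℝ) : f y = ∑ i, y i * f (Pi.single i 1) := by
    conv_lhs => rw [← Finset.univ_sum_single y, map_sum]
    refine Finset.sum_congr rfl fun i _ => ?_
    rw [← smul_eq_mul, ← map_smul, ← Pi.single_smul, smul_eq_mul, mul_one]
  have hnonpos (i : ι) : f (Pi.single i 1) ≤ 0 := by
    by_contra! hi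
    have hz : v < f z := hfv z Set.self_mem_Iic
    have hle : z - ((f z - v) / f (Pi.single i 1)) • (Pi.single i 1 : ι → ℝ) ≤ z :=
      sub_le_self _ (smul_nonneg (div_nonneg (sub_pos.2 hz).le hi.le)
        (Pi.single_nonneg.2 zero_le_one))
    have hlt := hfv _ hle
    rw [map_sub, map_smul, smul_eq_mul, div_mul_cancel₀ _ hi.ne'] at hlt
    linarith
  obtain ⟨c, hc, hcz⟩ := h (fun i => -f (Pi.single i 1)) fun i => neg_nonneg.2 (hnonpos i)
  simp only [mul_neg, Finset.sum_neg_distrib, ← hf] at hcz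
  linarith [hfu c (subset_convexHull ℝ _ hc), hfv z Set.self_mem_Iic]

/-- The overall metarounding guarantee (Lemma 1 + Theorem 2): under the
relax-based `α`-approximation oracle hypothesis at `x`, there is a distribution
`λ` over `C` with `E_{c∼λ}[c]·ℓ ≤ (α + ε) (x·ℓ)` for every `ℓ ∈ L`. -/
theorem stmt_12 (n : ℕ) (hn : 1 ≤ n) (x : Fin n → ℝ) (hx : ∀ i, 0 < x i)
    (M : ℝ)
    (hM : M = Finset.univ.sup' (⟨⟨0, hn⟩, Finset.mem_univ _⟩ :
      (Finset.univ : Finset (Fin n)).Nonempty) (fun i => 1 / x i))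
    (L : Set (Fin n → ℝ))
    (hL : L = {ℓ : Fin n → ℝ | (∀ i, 0 ≤ ℓ i ∧ ℓ i ≤ M) ∧ (∑ i, ℓ i * x i) = 1})
    (C : Finset (Fin n → ℝ)) (hC : C.Nonempty) (hCpos : ∀ c ∈ C, ∀ i, 0 ≤ c i)
    (α ε : ℝ) (hα : 1 ≤ α) (hε : 0 < ε)
    (horacle : ∀ ℓ ∈ L, ∃ c ∈ C, (∑ i, c i * ℓ i) ≤ α) :
    ∃ lam : (Fin n → ℝ) → ℝ,
      (∀ c ∈ C, 0 ≤ lam c) ∧ (∑ c ∈ C, lam c) = 1 ∧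
      ∀ ℓ ∈ L, (∑ i, (∑ c ∈ C, lam c * c i) * ℓ i) ≤ (α + ε) * ∑ i, x i * ℓ i := by
  subst hL
  have hdual (p : Fin n → ℝ) (hp : ∀ i, 0 ≤ p i) :
      ∃ c ∈ C, ∑ i, c i * p i ≤ ∑ i, (α • x) i * p i := by
    have hpx (i : Fin n) : 0 ≤ p i * x i := mul_nonneg (hp i) (hx i).le
    set S := ∑ i, p i * x i with hS
    have hαS : ∑ i, (α • x) i * p i = α * S := by
      simp only [hS, Finset.mul_sum, Pi.smul_apply, smul_eq_mul]
      exact Finset.sum_congr rfl fun i _ => by ring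
    rw [hαS]
    rcases (Finset.sum_nonneg fun i _ => hpx i : 0 ≤ S).eq_or_lt with h0 | hpos
    · obtain ⟨c, hc⟩ := hC
      have hp0 (i : Fin n) : p i = 0 :=
        (mul_eq_zero.1 ((Finset.sum_eq_zero_iff_of_nonneg fun i _ => hpx i).1 h0.symm i
          (Finset.mem_univ i))).resolve_right (hx i).ne'
      exact ⟨c, hc, by simp [hS, hp0]⟩
    · have hbound (i : Fin n) : p i / S ≤ M := calc
        p i / S ≤ 1 / x i := by
          rw [div_le_div_iff₀ hpos (hx i), one_mul]
          exact Finset.single_le_sum (fun j _ => hpx j) (Finset.mem_univ i)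
        _ ≤ M := hM ▸ Finset.le_sup' (fun i => 1 / x i) (Finset.mem_univ i)
      have hnorm : ∑ i, p i / S * x i = 1 := by
        simp only [div_mul_eq_mul_div, ← Finset.sum_div]
        exact div_self hpos.ne'
      obtain ⟨c, hc, hle⟩ := horacle (fun i => p i / S)
        ⟨fun i => ⟨div_nonneg (hp i) hpos.le, hbound i⟩, hnorm⟩
      refine ⟨c, hc, ?_⟩
      simp only [← mul_div_assoc, ← Finset.sum_div] at hle
      exact (div_le_iff₀ hpos).1 hle
  obtain ⟨y, hy, hyx⟩ := exists_mem_convexHull_le C (α • x) hdual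
  obtain ⟨lam, hlam, hsum, rfl⟩ := Finset.mem_convexHull'.1 hy
  refine ⟨lam, hlam, hsum, fun ℓ hℓ => ?_⟩
  rw [Finset.mul_sum]
  refine Finset.sum_le_sum fun i _ => ?_
  have hi := hyx i
  simp only [Finset.sum_apply, Pi.smul_apply, smul_eq_mul] at hi
  rw [← mul_assoc]
  refine mul_le_mul_of_nonneg_right (hi.trans ?_) (hℓ.1 i).1
  exact mul_le_mul_of_nonneg_right (le_add_of_nonneg_right hε.le) (hx i).le
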